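/- Let R be a local Cohen–Macaulay ring and let I be a height two perfect R-ideal. Then for all i with H_i(I) ≠ 0, one has Ann(H_i(I)) = I, where H_i(I) is the i-th Koszul homology module of a minimal generating set of I. -/

import Mathlib

universe u

/-- `x` is integral over the ideal `I`: it satisfies an equation
`x^m + b_1 x^{m-1} + ... + b_m = 0` with `b_j ∈ I^j` and `m ≥ 1`. -/
def Ideal.IsIntegralElem' {R : Type*} [CommRing R] (I : Ideal R) (x : R) : Prop :=
  ∃ m : ℕ, 0 < m ∧ ∃ b : ℕ → R, (∀ j, 1 ≤ j → j ≤ m → b j ∈ I ^ j) ∧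
    x ^ m + ∑ j ∈ Finset.Icc 1 m, b j * x ^ (m - j) = 0

/-- The integral closure of an ideal, as an ideal.  (Since the set of elements integral
over `I` is an ideal, taking the span adds nothing.) -/
def Ideal.intClosure {R : Type*} [CommRing R] (I : Ideal R) : Ideal R :=
  Ideal.span {x | I.IsIntegralElem' x}

/-- An ideal is integrally closed if it contains every element integral over it. -/
def Ideal.IsIntClosed {R : Type*} [CommRing R] (I : Ideal R) : Prop :=
  ∀ x, I.IsIntegralElem' x → x ∈ I

/-- The minimal number of generators of an ideal. -/
noncomputable def Ideal.mu {R : Type*} [CommRing R] (I : Ideal R) : ℕ :=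
  sInf {n | ∃ f : Fin n → R, Ideal.span (Set.range f) = I}
section Koszul

variable {R : Type*} [CommRing R] {n : ℕ}

/-- The linear functional on `Fin n → R` determined by the sequence `a`. -/
noncomputable def koszulDual (a : Fin n → R) : Module.Dual R (Fin n → R) :=
  ∑ j, a j • LinearMap.proj j

/-- The Koszul differential on the exterior algebra of `Fin n → R`:
contraction with the dual element determined by `a`. -/
noncomputable def koszulDiff (a : Fin n → R) :
    ExteriorAlgebra R (Fin n → R) →ₗ[R] ExteriorAlgebra R (Fin n → R) :=
  CliffordAlgebra.contractLeft (koszulDual a)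

/-- The `i`-th graded piece of the exterior algebra of `Fin n → R`, i.e. the `i`-th
term of the Koszul complex. -/
noncomputable def koszulPiece (R : Type*) [CommRing R] (n i : ℕ) :
    Submodule R (ExteriorAlgebra R (Fin n → R)) :=
  LinearMap.range (ExteriorAlgebra.ι R (M := Fin n → R)) ^ i

/-- The `i`-cycles of the Koszul complex of the sequence `a`. -/
noncomputable def koszulCycles (a : Fin n → R) (i : ℕ) :
    Submodule R (ExteriorAlgebra R (Fin n → R)) :=
  koszulPiece R n i ⊓ LinearMap.ker (koszulDiff a)

/-- The `i`-boundaries of the Koszul complex of the sequence `a`. -/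
noncomputable def koszulBoundaries (a : Fin n → R) (i : ℕ) :
    Submodule R (ExteriorAlgebra R (Fin n → R)) :=
  Submodule.map (koszulDiff a) (koszulPiece R n (i + 1))

/-- The `i`-th Koszul homology module `H_i(a)` of the sequence `a`. -/
noncomputable def koszulHomology (a : Fin n → R) (i : ℕ) : Type _ :=
  koszulCycles a i ⧸ (koszulBoundaries a i).comap (koszulCycles a i).subtype

noncomputable instance (a : Fin n → R) (i : ℕ) : AddCommGroup (koszulHomology a i) :=
  inferInstanceAs (AddCommGroup
    (koszulCycles a i ⧸ (koszulBoundaries a i).comap (koszulCycles a i).subtype))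

noncomputable instance (a : Fin n → R) (i : ℕ) : Module R (koszulHomology a i) :=
  inferInstanceAs (Module R
    (koszulCycles a i ⧸ (koszulBoundaries a i).comap (koszulCycles a i).subtype))

/-- The annihilator ideal of the `i`-th Koszul homology of `a`. -/
noncomputable def koszulAnn (a : Fin n → R) (i : ℕ) : Ideal R :=
  Module.annihilator R (koszulHomology a i)

end Koszul

/-- `a` is a minimal generating sequence for the ideal `I`. -/
def IsMinGen {R : Type*} [CommRing R] {n : ℕ} (a : Fin n → R) (I : Ideal R) : Prop :=
  Ideal.span (Set.range a) = I ∧ n = I.mu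
/-- The height of an ideal: the infimum of the heights of the primes containing it. -/
noncomputable def idealHeight {R : Type*} [CommRing R] (I : Ideal R) : ℕ∞ :=
  ⨅ (p : PrimeSpectrum R) (_ : I ≤ p.asIdeal), Order.height p

/-- A local ring is Cohen–Macaulay if some regular sequence in the maximal ideal has
length equal to the Krull dimension of the ring (i.e. depth = dim). -/
def IsCohenMacaulayLocalRing (R : Type*) [CommRing R] [IsLocalRing R] : Prop :=
  ∃ l : List R, (∀ x ∈ l, x ∈ IsLocalRing.maximalIdeal R) ∧
    RingTheory.Sequence.IsRegular R l ∧ ringKrullDim R = l.length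

/-- The ideal `I` has grade `g`: it contains a regular sequence of length `g` but none
of length `g + 1`. -/
def Ideal.HasGrade {R : Type*} [CommRing R] (I : Ideal R) (g : ℕ) : Prop :=
  (∃ l : List R, (∀ x ∈ l, x ∈ I) ∧ RingTheory.Sequence.IsRegular R l ∧ l.length = g) ∧
    ¬∃ l : List R, (∀ x ∈ l, x ∈ I) ∧ RingTheory.Sequence.IsRegular R l ∧ l.length = g + 1
open CategoryTheory in
/-- `Ext^n_R(M, N)`, via the derived functor `Ext` on `ModuleCat R`. -/
noncomputable def ExtMod (R : Type u) [CommRing R] (M N : Type u)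
    [AddCommGroup M] [Module R M] [AddCommGroup N] [Module R N] (n : ℕ) : Type u :=
  ((Ext R (ModuleCat.{u} R) n).obj (Opposite.op (ModuleCat.of R M))).obj (ModuleCat.of R N)

open CategoryTheory in
noncomputable instance (R : Type u) [CommRing R] (M N : Type u)
    [AddCommGroup M] [Module R M] [AddCommGroup N] [Module R N] (n : ℕ) :
    AddCommGroup (ExtMod R M N n) :=
  inferInstanceAs (AddCommGroup
    (((Ext R (ModuleCat.{u} R) n).obj (Opposite.op (ModuleCat.of R M))).obj (ModuleCat.of R N)))

open CategoryTheory in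
noncomputable instance (R : Type u) [CommRing R] (M N : Type u)
    [AddCommGroup M] [Module R M] [AddCommGroup N] [Module R N] (n : ℕ) :
    Module R (ExtMod R M N n) :=
  inferInstanceAs (Module R
    (((Ext R (ModuleCat.{u} R) n).obj (Opposite.op (ModuleCat.of R M))).obj (ModuleCat.of R N)))

/-- `M` has projective dimension at most `n`: `Ext^{n+1}(M, -)` vanishes. -/
noncomputable def HasProjDimLE (R : Type u) [CommRing R] (M : Type u)
    [AddCommGroup M] [Module R M] (n : ℕ) : Prop :=
  ∀ (N : Type u) [AddCommGroup N] [Module R N], Subsingleton (ExtMod R M N (n + 1))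

/-- `M` has projective dimension exactly `n` (in particular, finite). -/
noncomputable def ProjDimEq (R : Type u) [CommRing R] (M : Type u)
    [AddCommGroup M] [Module R M] (n : ℕ) : Prop :=
  HasProjDimLE R M n ∧ ∀ m, HasProjDimLE R M m → n ≤ m

/-- `M` has projective dimension `< n` (with the convention `pd 0 = -∞`). -/
noncomputable def ProjDimLT (R : Type u) [CommRing R] (M : Type u)
    [AddCommGroup M] [Module R M] (n : ℕ) : Prop :=
  Subsingleton M ∨ ∃ k, n = k + 1 ∧ HasProjDimLE R M k


open CategoryTheory Limits

section ProjDim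

variable {R : Type u} [CommRing R]

theorem exists_d_comp_eq_of_linearYonedaObj_exactAt (C : ChainComplex (ModuleCat.{u} R) ℕ)
    (Y : ModuleCat.{u} R) (n : ℕ)
    (h : (C.linearYonedaObj R Y).ExactAt (n + 1)) (f : C.X (n + 1) ⟶ Y)
    (hf : C.d (n + 2) (n + 1) ≫ f = 0) : ∃ s : C.X n ⟶ Y, C.d (n + 1) n ≫ s = f := by
  rw [HomologicalComplex.exactAt_iff' _ n (n + 1) (n + 2) (by simp) (by simp)] at h
  rw [ShortComplex.moduleCat_exact_iff] at h
  exact h f hf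

theorem shortExact_opcycles (C : ChainComplex (ModuleCat.{u} R) ℕ)
    (n : ℕ) (h : C.ExactAt (n + 1)) :
    (ShortComplex.mk (C.fromOpcycles (n + 1) n) (C.pOpcycles n) (by
      rw [← cancel_epi (C.pOpcycles (n + 1))]; simp)).ShortExact := by
  have hmono : Mono (C.fromOpcycles (n + 1) n) :=
    Preadditive.mono_of_isZero_kernel' _ (C.homologyIsKernel (n + 1) n (by simp))
      h.isZero_homology
  have hex : (ShortComplex.mk (C.d (n + 1) n) (C.pOpcycles n) (by simp)).Exact :=
    ShortComplex.exact_of_g_is_cokernel _ (C.opcyclesIsCokernel (n + 1) n (by simp))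
  let φ : ShortComplex.mk (C.d (n + 1) n) (C.pOpcycles n) (by simp) ⟶
      ShortComplex.mk (C.fromOpcycles (n + 1) n) (C.pOpcycles n) (by
        rw [← cancel_epi (C.pOpcycles (n + 1))]; simp) :=
    { τ₁ := C.pOpcycles (n + 1)
      τ₂ := 𝟙 _
      τ₃ := 𝟙 _ }
  have : Epi φ.τ₁ := inferInstanceAs (Epi (C.pOpcycles (n + 1)))
  have : IsIso φ.τ₂ := inferInstanceAs (IsIso (𝟙 (C.X n)))
  have : Mono φ.τ₃ := inferInstanceAs (Mono (𝟙 (C.opcycles n)))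
  exact
    { exact := (ShortComplex.exact_iff_of_epi_of_isIso_of_mono φ).1 hex
      mono_f := hmono
      epi_g := inferInstanceAs (Epi (C.pOpcycles n)) }

/-- If `Ext^(n+1)(M, -)` vanishes then `M` has projective dimension at most `n`. -/
theorem HasProjDimLE.hasProjectiveDimensionLT {M : Type u} [AddCommGroup M] [Module R M] {n : ℕ}
    (h : HasProjDimLE R M n) : HasProjectiveDimensionLT (ModuleCat.of R M) (n + 1) := by
  let P := ProjectiveResolution.of (ModuleCat.of R M)
  let C := P.complex
  have hS := fun m ↦ shortExact_opcycles C m (P.complex_exactAt_succ m)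
  have hexact : (C.linearYonedaObj R (C.opcycles (n + 1))).ExactAt (n + 1) := by
    rw [HomologicalComplex.exactAt_iff_isZero_homology]
    refine IsZero.of_iso ?_ (P.isoExt (n + 1) (C.opcycles (n + 1))).symm
    have := h (C.opcycles (n + 1))
    exact @ModuleCat.isZero_of_subsingleton _ _ _ this
  obtain ⟨s, hs⟩ := exists_d_comp_eq_of_linearYonedaObj_exactAt C _ n hexact
    (C.pOpcycles (n + 1)) (by simp)
  have hs' : C.fromOpcycles (n + 1) n ≫ s = 𝟙 _ := by
    rw [← cancel_epi (C.pOpcycles (n + 1))]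
    simpa using hs
  have hproj : Projective (C.opcycles n) := by
    have sp := ShortComplex.Splitting.ofExactOfRetraction _ (hS n).exact s hs' (hS n).epi_g
    have := P.projective n
    exact (Retract.mk sp.s (C.pOpcycles n) sp.s_g).projective
  have hshift : ∀ m ≤ n, HasProjectiveDimensionLT (C.opcycles (n - m)) (m + 1) := by
    intro m
    induction m with
    | zero => intro _; simpa using (inferInstance : HasProjectiveDimensionLT (C.opcycles n) 1)
    | succ m ih =>
      intro hm
      have h1 := ih (by lia)
      have hS' := hS (n - (m + 1))
      rw [show n - (m + 1) + 1 = n - m by lia] at hS'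
      have := P.projective (n - (m + 1))
      have h2 : HasProjectiveDimensionLT (C.X (n - (m + 1))) (m + 1 + 1) := by
        have : HasProjectiveDimensionLT (C.X (n - (m + 1))) 1 := inferInstance
        exact hasProjectiveDimensionLT_of_ge _ 1 _ (by lia)
      exact hS'.hasProjectiveDimensionLT_X₃ (m + 1) h1 h2
  have h0 := hshift n le_rfl
  rw [Nat.sub_self] at h0
  exact @hasProjectiveDimensionLT_of_iso _ _ _ (C.opcycles 0) _
    (IsColimit.coconePointUniqueUpToIso (C.opcyclesIsCokernel 1 0 (by simp))
      P.isColimitCokernelCofork) _ h0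

end ProjDim

section Grade

open RingTheory.Sequence
open scoped Pointwise

variable {R : Type u} [CommRing R]

theorem length_le_height_of_isWeaklyRegular [IsNoetherianRing R] {p : Ideal R} [p.IsPrime]
    {l : List R} (hl : IsWeaklyRegular R l) (hmem : ∀ x ∈ l, x ∈ p) :
    (l.length : ℕ∞) ≤ p.height := by
  let S := Localization.AtPrime p
  have hreg : IsRegular S (l.map (algebraMap R S)) := hl.isRegular_of_isLocalization_of_mem S p hmem
  have hdim := ringKrullDim_add_length_eq_ringKrullDim_of_isRegular _ hreg
  have hne : Ideal.ofList (l.map (algebraMap R S)) ≠ ⊤ := by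
    simpa using hreg.2.symm
  have : Nontrivial (S ⧸ Ideal.ofList (l.map (algebraMap R S))) :=
    Ideal.Quotient.nontrivial_iff.2 hne
  have h0 := ringKrullDim_nonneg_of_nontrivial
    (R := S ⧸ Ideal.ofList (l.map (algebraMap R S)))
  rw [IsLocalization.AtPrime.ringKrullDim_eq_height p S, List.length_map] at hdim
  have : ((l.length : ℕ∞) : WithBot ℕ∞) ≤ (p.height : WithBot ℕ∞) := by
    rw [← hdim]
    exact le_add_of_nonneg_left h0
  exact_mod_cast this

theorem idealHeight_eq_height (I : Ideal R) : idealHeight I = I.height := by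
  refine le_antisymm ?_ (le_iInf₂ fun p hp ↦ ?_)
  · rw [Ideal.height_eq_inf_minimalPrimes]
    refine le_iInf₂ fun p hp ↦ ?_
    exact (iInf₂_le (⟨p, hp.isPrime⟩ : PrimeSpectrum R) hp.1.2).trans
      (PrimeSpectrum.height_eq_orderHeight _).ge
  · exact (Ideal.height_mono hp).trans p.height_eq_orderHeight.le

theorem ModuleCat.shortExact_of_exact {L M N : Type u} [AddCommGroup L] [Module R L]
    [AddCommGroup M] [Module R M] [AddCommGroup N] [Module R N] {f : L →ₗ[R] M} {g : M →ₗ[R] N}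
    (hf : Function.Injective f) (hfg : Function.Exact f g) (hg : Function.Surjective g) :
    (ShortComplex.mk (ModuleCat.ofHom f) (ModuleCat.ofHom g)
      (by rw [← ModuleCat.ofHom_comp, hfg.linearMap_comp_eq_zero]; rfl)).ShortExact where
  exact := by
    rw [ShortComplex.moduleCat_exact_iff]
    exact fun x hx ↦ (hfg x).1 hx
  mono_f := (ModuleCat.mono_iff_injective _).2 hf
  epi_g := (ModuleCat.epi_iff_surjective _).2 hg

theorem hasProjectiveDimensionLT_ideal {I : Ideal R} {g : ℕ} (h : HasProjDimLE R (R ⧸ I) g)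
    {m : ℕ} (hm : g ≤ m + 1) : HasProjectiveDimensionLT (ModuleCat.of R I) (m + 1) := by
  have h3 := h.hasProjectiveDimensionLT
  have h3' : HasProjectiveDimensionLT (ModuleCat.of R (R ⧸ I)) (m + 2) :=
    hasProjectiveDimensionLT_of_ge _ (g + 1) _ (by lia)
  have hS := ModuleCat.shortExact_of_exact I.subtype_injective
    (LinearMap.exact_subtype_mkQ I) I.mkQ_surjective
  exact (hS.hasProjectiveDimensionLT_X₃_iff m
    (inferInstanceAs (Projective (ModuleCat.of R R)))).1 h3'

/-- A projective ideal in a Noetherian local ring is principal. -/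
theorem isPrincipal_of_projective [IsLocalRing R] [IsNoetherianRing R] (I : Ideal R)
    [Module.Projective R I] : I.IsPrincipal := by
  have : Module.Free R I := Module.free_of_flat_of_isLocalRing
  let b := Module.Free.chooseBasis R I
  have hsub : ∀ i j : Module.Free.ChooseBasisIndex R I, i = j := by
    intro i j
    by_contra hij
    have hcomm : (b j : R) • b i = (b i : R) • b j := Subtype.ext (mul_comm _ _)
    have hzero := congrArg (fun v ↦ b.repr v i) hcomm
    simp only [map_smul, Module.Basis.repr_self, Finsupp.smul_apply, Finsupp.single_eq_same,
      Finsupp.single_eq_of_ne hij, smul_eq_mul, mul_one, mul_zero] at hzero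
    exact b.ne_zero j (Subtype.ext hzero)
  rcases isEmpty_or_nonempty (Module.Free.ChooseBasisIndex R I) with he | ⟨⟨i⟩⟩
  · have : Subsingleton I := b.repr.toEquiv.subsingleton
    rw [(Submodule.eq_bot_iff I).2 fun x hx ↦ congrArg Subtype.val
      (Subsingleton.elim (⟨x, hx⟩ : I) 0)]
    infer_instance
  · refine ⟨(b i : R), le_antisymm (fun x hx ↦ ?_) ?_⟩
    · have hx' := congrArg Subtype.val (b.sum_repr ⟨x, hx⟩)
      rw [Submodule.mem_span_singleton]
      refine ⟨b.repr ⟨x, hx⟩ i, ?_⟩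
      have : Unique (Module.Free.ChooseBasisIndex R I) := ⟨⟨i⟩, fun j ↦ hsub j i⟩
      rw [Fintype.sum_unique, hsub default i] at hx'
      exact hx'
    · rw [Submodule.span_le, Set.singleton_subset_iff]
      exact (b i).2

theorem projDim_eq_two_of_height_eq_two [IsLocalRing R] [IsNoetherianRing R] {I : Ideal R}
    (hht : I.height = 2) {g : ℕ} (hg : I.HasGrade g) (hpd : HasProjDimLE R (R ⧸ I) g) :
    g = 2 := by
  refine le_antisymm ?_ ?_
  · obtain ⟨⟨l, hl, hreg, rfl⟩, -⟩ := hg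
    obtain ⟨p, hp, hIp, hph⟩ := Ideal.exists_isPrime_height_eq (I := I) (n := 2) hht
    have := length_le_height_of_isWeaklyRegular hreg.1 (fun x hx ↦ hIp (hl x hx))
    rw [hph] at this
    exact_mod_cast this
  · by_contra! hlt
    have := hasProjectiveDimensionLT_ideal hpd (m := 0) (by lia)
    have hproj : Projective (ModuleCat.of R I) := inferInstance
    have : Module.Projective R I := (IsProjective.iff_projective _).2 hproj
    have hprin := isPrincipal_of_projective I
    obtain ⟨x, rfl⟩ := hprin
    have h1 := Ideal.height_span_singleton_le_one (x := x) (by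
      intro hx
      have h2 := Ideal.span_singleton_eq_top.2 hx
      rw [Ideal.submodule_span_eq, h2, Ideal.height_top] at hht
      simp at hht)
    rw [Ideal.submodule_span_eq] at hht
    rw [hht] at h1
    norm_num at h1

theorem projective_ker_of_hasProjDimLE_two {n : ℕ} (f : (Fin n → R) →ₗ[R] R)
    (h : HasProjDimLE R (R ⧸ LinearMap.range f) 2) : Module.Projective R (LinearMap.ker f) := by
  have h1 := hasProjectiveDimensionLT_ideal h (m := 1) le_rfl
  have hS := ModuleCat.shortExact_of_exact (LinearMap.ker f.rangeRestrict).subtype_injective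
    (LinearMap.exact_subtype_ker_map _) f.surjective_rangeRestrict
  have h2 := (hS.hasProjectiveDimensionLT_X₃_iff 0
    (inferInstanceAs (Projective (ModuleCat.of R (Fin n → R))))).1 h1
  have hproj : Projective (ModuleCat.of R (LinearMap.ker f.rangeRestrict)) :=
    @instProjectiveOfHasProjectiveDimensionLTOfNatNat _ _ _ _ h2
  rw [← LinearMap.ker_rangeRestrict]
  exact (IsProjective.iff_projective _).2 hproj

/-- `y, z` is a weakly regular sequence in `R`, in elementwise form. -/
structure IsRegularPair (y z : R) : Prop where
  eq_zero : ∀ r, y * r = 0 → r = 0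
  dvd : ∀ r, y ∣ z * r → y ∣ r

theorem exists_isRegularPair {I : Ideal R} (h : I.HasGrade 2) :
    ∃ y ∈ I, ∃ z ∈ I, IsRegularPair y z := by
  obtain ⟨⟨l, hl, hreg, hlen⟩, -⟩ := h
  obtain ⟨y, z, rfl⟩ := List.length_eq_two.1 hlen
  refine ⟨y, hl _ (by simp), z, hl _ (by simp), ?_⟩
  have h1 := hreg.1
  rw [isWeaklyRegular_cons_iff, isWeaklyRegular_cons_iff] at h1
  obtain ⟨hy, hz, -⟩ := h1
  refine ⟨fun r hr ↦ hy (by simpa using hr), fun r ⟨s, hs⟩ ↦ ?_⟩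
  have hmem : r ∈ y • (⊤ : Submodule R R) :=
    mem_of_isSMulRegular_quotient_of_smul_mem hz
      ((Submodule.mem_smul_pointwise_iff_exists _ _ _).2 ⟨s, trivial, hs.symm⟩)
  obtain ⟨t, -, ht⟩ := (Submodule.mem_smul_pointwise_iff_exists _ _ _).1 hmem
  exact ⟨t, ht.symm⟩

end Grade

section RegularPair

variable {R : Type u} [CommRing R]

theorem IsRegularPair.pow_eq_zero {y z : R} (h : IsRegularPair y z) (n : ℕ) {r : R}
    (hr : y ^ n * r = 0) : r = 0 := by
  induction n with
  | zero => simpa using hr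
  | succ n ih => exact ih (h.eq_zero _ (by rw [← hr]; ring))

theorem IsRegularPair.pow {y z : R} (h : IsRegularPair y z) (m n : ℕ) :
    IsRegularPair (y ^ m) (z ^ n) := by
  refine ⟨fun r ↦ h.pow_eq_zero m, ?_⟩
  have hz : ∀ k r, y ∣ z ^ k * r → y ∣ r := by
    intro k
    induction k with
    | zero => simp
    | succ k ih => exact fun r hr ↦ ih r (h.dvd _ (by rwa [pow_succ', mul_assoc] at hr))
  induction m with
  | zero => simp
  | succ m ih =>
    rintro r ⟨s, hs⟩
    obtain ⟨t, rfl⟩ := hz n r ⟨y ^ m * s, by rw [hs]; ring⟩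
    obtain ⟨c, rfl⟩ := ih t ⟨s, by
      rw [← sub_eq_zero]
      exact h.eq_zero _ (by linear_combination hs)⟩
    exact ⟨c, by ring⟩

end RegularPair

section KoszulHomology

open ExteriorAlgebra

variable {R : Type u} [CommRing R] {n : ℕ} (a : Fin n → R)

theorem koszulDual_apply (v : Fin n → R) : koszulDual a v = ∑ j, a j * v j := by
  simp [koszulDual, LinearMap.sum_apply]

theorem range_koszulDual : LinearMap.range (koszulDual a) = Ideal.span (Set.range a) := by
  ext x
  rw [Ideal.mem_span_range_iff_exists_fun]
  simp only [LinearMap.mem_range, koszulDual_apply, mul_comm]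

theorem koszulDiff_ι_mul (v : Fin n → R) (t : ExteriorAlgebra R (Fin n → R)) :
    koszulDiff a (ι R v * t) = koszulDual a v • t - ι R v * koszulDiff a t :=
  CliffordAlgebra.contractLeft_ι_mul ..

theorem ι_mul_mem_koszulPiece (v : Fin n → R) {i : ℕ} {t : ExteriorAlgebra R (Fin n → R)}
    (ht : t ∈ koszulPiece R n i) : ι R v * t ∈ koszulPiece R n (i + 1) := by
  rw [koszulPiece, pow_succ']
  exact Submodule.mul_mem_mul ⟨v, rfl⟩ ht

theorem koszulPiece_eq_bot {i : ℕ} (hi : n < i) : koszulPiece R n i = ⊥ := by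
  have hempty : IsEmpty (Set.powersetCard (Fin n) i) := by
    refine ⟨fun s ↦ ?_⟩
    have h1 := s.2
    have h2 := Finset.card_le_univ s.1
    rw [Set.powersetCard.mem_iff] at h1
    simp at h2
    lia
  have : Subsingleton (⋀[R]^i (Fin n → R)) :=
    ((Pi.basisFun R (Fin n)).exteriorPower i).repr.toEquiv.subsingleton
  exact (Submodule.subsingleton_iff_eq_bot).1 this

/-- Nonzerodivisors of `R` act injectively on the Koszul complex. -/
theorem eq_zero_of_smul_eq_zero {y : R} (hy : ∀ r, y * r = 0 → r = 0)
    {t : ExteriorAlgebra R (Fin n → R)} (ht : y • t = 0) : t = 0 := by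
  let b := (Pi.basisFun R (Fin n)).ExteriorAlgebra
  refine b.ext_elem fun s ↦ ?_
  rw [map_zero, Finsupp.zero_apply]
  apply hy
  have := congrArg (fun u ↦ b.repr u s) ht
  simpa using this

/-- The standard generator of the top exterior power. -/
noncomputable def koszulTop (R : Type u) [CommRing R] (n : ℕ) : ExteriorAlgebra R (Fin n → R) :=
  ιMulti R n (Pi.basisFun R (Fin n))

/-- The coordinate on the top exterior power, given by the determinant. -/
noncomputable def koszulTopCoord (R : Type u) [CommRing R] (n : ℕ) :
    ExteriorAlgebra R (Fin n → R) →ₗ[R] R :=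
  liftAlternating (Pi.single (M := fun i ↦ (Fin n → R) [⋀^Fin i]→ₗ[R] R) n
    Matrix.detRowAlternating)

theorem koszulTopCoord_ιMulti (v : Fin n → Fin n → R) :
    koszulTopCoord R n (ιMulti R n v) = Matrix.det (Matrix.of v) := by
  rw [koszulTopCoord, liftAlternating_apply_ιMulti, Pi.single_eq_same]
  rfl

theorem koszulTopCoord_koszulTop : koszulTopCoord R n (koszulTop R n) = 1 := by
  rw [koszulTop, koszulTopCoord_ιMulti]
  convert Matrix.det_one (R := R) (n := Fin n)
  ext i j
  simp [Matrix.one_apply, Pi.single_apply, eq_comm]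

theorem eq_smul_koszulTop {t : ExteriorAlgebra R (Fin n → R)} (ht : t ∈ koszulPiece R n n) :
    t = koszulTopCoord R n t • koszulTop R n := by
  have hmulti : ιMulti R n = ((LinearMap.toSpanSingleton R _ (koszulTop R n)) ∘ₗ
      koszulTopCoord R n).compAlternatingMap (ιMulti R n (M := Fin n → R)) := by
    refine Module.Basis.ext_alternating (Pi.basisFun R (Fin n)) fun v hv ↦ ?_
    let σ : Equiv.Perm (Fin n) := Equiv.ofBijective v (Finite.injective_iff_bijective.1 hv)
    have h1 : (fun i ↦ Pi.basisFun R (Fin n) (v i)) = (Pi.basisFun R (Fin n)) ∘ σ := rfl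
    rw [h1, AlternatingMap.map_perm, AlternatingMap.map_perm]
    congr 1
    change koszulTop R n = koszulTopCoord R n (koszulTop R n) • koszulTop R n
    rw [koszulTopCoord_koszulTop, one_smul]
  have hspan : t ∈ Submodule.span R (Set.range (ιMulti R n (M := Fin n → R))) := by
    rw [ιMulti_span_fixedDegree]
    exact ht
  induction hspan using Submodule.span_induction with
  | mem x hx =>
    obtain ⟨v, rfl⟩ := hx
    exact congrArg (fun f ↦ f v) hmulti
  | zero => simp
  | add x y hx hy ihx ihy =>
    rw [ιMulti_span_fixedDegree] at hx hy
    rw [map_add, add_smul, ← ihx hx, ← ihy hy]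
  | smul r x hx ih =>
    rw [ιMulti_span_fixedDegree] at hx
    rw [map_smul, smul_assoc, ← ih hx]

theorem koszulTop_mem : koszulTop R n ∈ koszulPiece R n n :=
  ιMulti_range R n ⟨_, rfl⟩

variable {a}

theorem eq_zero_of_smul_koszulDiff_koszulTop {g : Fin n → R}
    (hg : ∀ r, koszulDual a g * r = 0 → r = 0) {r : R}
    (hr : r • koszulDiff a (koszulTop R n) = 0) : r = 0 := by
  have h0 : ι R g * koszulTop R n = 0 := by
    have := ι_mul_mem_koszulPiece g (koszulTop_mem (R := R) (n := n))
    rwa [koszulPiece_eq_bot (Nat.lt_succ_self n)] at this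
  have h1 := koszulDiff_ι_mul a g (koszulTop R n)
  rw [h0, map_zero, eq_comm, sub_eq_zero] at h1
  have h2 : (koszulDual a g * r) • koszulTop R n = 0 := by
    rw [mul_comm, mul_smul, h1, ← mul_smul_comm, hr, mul_zero]
  have h3 := congrArg (koszulTopCoord R n) h2
  rw [map_smul, koszulTopCoord_koszulTop, map_zero, smul_eq_mul, mul_one] at h3
  exact hg r h3

theorem koszulCycles_le_koszulBoundaries {g h : Fin n → R}
    (hgh : IsRegularPair (koszulDual a g) (koszulDual a h)) {i : ℕ} (hi : n ≤ i + 1) :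
    koszulCycles a i ≤ koszulBoundaries a i := by
  intro t hcyc
  obtain ⟨ht, hdt⟩ := Submodule.mem_inf.1 hcyc
  rw [LinearMap.mem_ker] at hdt
  rcases lt_trichotomy n i with hlt | rfl | hgt
  · rw [koszulPiece_eq_bot hlt, Submodule.mem_bot] at ht
    rw [ht]
    exact zero_mem _
  · rw [eq_smul_koszulTop ht, map_smul] at hdt
    rw [eq_smul_koszulTop ht, eq_zero_of_smul_koszulDiff_koszulTop hgh.eq_zero hdt, zero_smul]
    exact zero_mem _
  · obtain rfl : n = i + 1 := by lia
    have key : ∀ v : Fin (i + 1) → R, ∃ c : R,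
        koszulDual a v • t = c • koszulDiff a (koszulTop R (i + 1)) := by
      intro v
      have h1 := koszulDiff_ι_mul a v t
      rw [hdt, mul_zero, sub_zero, eq_smul_koszulTop (ι_mul_mem_koszulPiece v ht), map_smul] at h1
      exact ⟨_, h1.symm⟩
    obtain ⟨c, hc⟩ := key g
    obtain ⟨c', hc'⟩ := key h
    have hcc : koszulDual a h * c = koszulDual a g * c' := by
      rw [← sub_eq_zero]
      apply eq_zero_of_smul_koszulDiff_koszulTop hgh.eq_zero
      rw [sub_smul, mul_smul, mul_smul, ← hc, ← hc', smul_comm, sub_self]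
    obtain ⟨s, rfl⟩ := hgh.dvd c ⟨c', hcc⟩
    refine ⟨s • koszulTop R (i + 1), Submodule.smul_mem _ _ koszulTop_mem, ?_⟩
    rw [map_smul, ← sub_eq_zero]
    apply eq_zero_of_smul_eq_zero hgh.eq_zero
    rw [smul_sub, hc, mul_smul, sub_self]

theorem mem_koszulAnn_iff {i : ℕ} {x : R} :
    x ∈ koszulAnn a i ↔ ∀ t ∈ koszulCycles a i, x • t ∈ koszulBoundaries a i := by
  rw [koszulAnn, Module.mem_annihilator]
  constructor
  · intro hx t ht
    let t' : koszulCycles a i := ⟨t, ht⟩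
    exact (Submodule.Quotient.mk_eq_zero
      ((koszulBoundaries a i).comap (koszulCycles a i).subtype) (x := x • t')).1
      (hx (Submodule.Quotient.mk t'))
  · intro hx m
    obtain ⟨t, rfl⟩ := Submodule.Quotient.mk_surjective _ m
    exact (Submodule.Quotient.mk_eq_zero
      ((koszulBoundaries a i).comap (koszulCycles a i).subtype) (x := x • t)).2 (hx t t.2)

theorem koszulDual_mem_koszulAnn (v : Fin n → R) (i : ℕ) :
    koszulDual a v ∈ koszulAnn a i := by
  rw [mem_koszulAnn_iff]
  intro t hcyc
  obtain ⟨ht, hdt⟩ := Submodule.mem_inf.1 hcyc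
  rw [LinearMap.mem_ker] at hdt
  exact ⟨ι R v * t, ι_mul_mem_koszulPiece v ht, by
    rw [koszulDiff_ι_mul, hdt, mul_zero, sub_zero]⟩

theorem not_nontrivial_koszulHomology {g h : Fin n → R}
    (hgh : IsRegularPair (koszulDual a g) (koszulDual a h)) {i : ℕ} (hi : n ≤ i + 1) :
    ¬ Nontrivial (koszulHomology a i) := by
  rw [not_nontrivial_iff_subsingleton]
  exact Submodule.Quotient.subsingleton_iff.2
    (Submodule.comap_subtype_eq_top.2 (koszulCycles_le_koszulBoundaries hgh hi))

theorem koszulDiff_ιMulti_eq_zero {p : ℕ} {v : Fin p → Fin n → R}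
    (hv : ∀ j, koszulDual a (v j) = 0) : koszulDiff a (ιMulti R p v) = 0 := by
  induction p with
  | zero => simp [koszulDiff]
  | succ p ih =>
    rw [ιMulti_succ_apply, koszulDiff_ι_mul, hv, zero_smul,
      ih (v := Matrix.vecTail v) (fun j ↦ hv j.succ), mul_zero, sub_zero]

theorem smul_ιMulti_mem_koszulBoundaries {i : ℕ} {x : R} (hx : x ∈ koszulAnn a i) {p : ℕ}
    (hp : i ≤ p) {v : Fin p → Fin n → R} (hv : ∀ j, koszulDual a (v j) = 0) :
    x • ιMulti R p v ∈ koszulBoundaries a p := by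
  induction p, hp using Nat.le_induction with
  | base =>
    exact mem_koszulAnn_iff.1 hx _
      ⟨ιMulti_range R i ⟨v, rfl⟩, koszulDiff_ιMulti_eq_zero hv⟩
  | succ p hp ih =>
    obtain ⟨w, hw, hdw⟩ := ih (v := Matrix.vecTail v) fun j ↦ hv j.succ
    refine ⟨-(ι R (v 0) * w), neg_mem (ι_mul_mem_koszulPiece _ hw), ?_⟩
    rw [map_neg, koszulDiff_ι_mul, hv, zero_smul, zero_sub, neg_neg, hdw, ιMulti_succ_apply,
      mul_smul_comm]

theorem exists_basis_ker_koszulDual [IsLocalRing R] [IsNoetherianRing R] {q : ℕ}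
    {a : Fin (q + 2) → R} {g : Fin (q + 2) → R} (hg : ∀ r, koszulDual a g * r = 0 → r = 0)
    (hproj : Module.Projective R (LinearMap.ker (koszulDual a))) :
    Nonempty (Module.Basis (Fin (q + 1)) R (LinearMap.ker (koszulDual a))) := by
  have : Module.Free R (LinearMap.ker (koszulDual a)) := Module.free_of_flat_of_isLocalRing
  let e : (LinearMap.ker (koszulDual a) × R) →ₗ[R] (Fin (q + 2) → R) :=
    (LinearMap.ker (koszulDual a)).subtype.coprod (LinearMap.toSpanSingleton R _ g)
  have he : Function.Injective e := by
    rw [injective_iff_map_eq_zero]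
    rintro ⟨f, r⟩ hfr
    have h0 : (f : Fin (q + 2) → R) + r • g = 0 := hfr
    have h1 := congrArg (koszulDual a) h0
    rw [map_add, f.2, zero_add, map_smul, map_zero, smul_eq_mul, mul_comm] at h1
    have hr := hg r h1
    rw [hr, zero_smul, add_zero] at h0
    exact Prod.ext (Subtype.ext h0) hr
  let f : (Fin (q + 2) → R) →ₗ[R] (LinearMap.ker (koszulDual a) × R) :=
    ((koszulDual a g • LinearMap.id - (koszulDual a).smulRight g).codRestrict _ (fun v ↦ by
      simp [mul_comm])).prod (koszulDual a)
  have hf : Function.Injective f := by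
    rw [injective_iff_map_eq_zero]
    intro v hv
    obtain ⟨h1, h2⟩ := Prod.ext_iff.1 hv
    have h1 : koszulDual a g • v - koszulDual a v • g = 0 := congrArg Subtype.val h1
    have h2 : koszulDual a v = 0 := h2
    rw [h2, zero_smul, sub_zero] at h1
    ext j
    exact hg _ (congrFun h1 j)
  have h1 := LinearMap.finrank_le_finrank_of_injective he
  have h2 := LinearMap.finrank_le_finrank_of_injective hf
  rw [Module.finrank_prod, Module.finrank_self, Module.finrank_fin_fun] at h1 h2
  exact ⟨Module.finBasisOfFinrankEq R _ (by lia)⟩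

section HilbertBurch

variable {q : ℕ} {a : Fin (q + 2) → R}
  (b : Module.Basis (Fin (q + 1)) R (LinearMap.ker (koszulDual a)))

/-- A power of each element of the ideal carries the boundary of the top form into the multiples
of the product of a basis of the syzygies. -/
theorem exists_pow_smul_koszulDiff_koszulTop (g : Fin (q + 2) → R) :
    ∃ c : R, koszulDual a g ^ (q + 2) • koszulDiff a (koszulTop R (q + 2)) =
      c • ιMulti R (q + 1) (fun j ↦ (b j : Fin (q + 2) → R)) := by
  set Z := ιMulti R (q + 1) (fun j ↦ (b j : Fin (q + 2) → R))
  have hZ : koszulDiff a Z = 0 := koszulDiff_ιMulti_eq_zero fun j ↦ (b j).2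
  let A : Matrix (Fin (q + 2)) (Fin (q + 2)) R :=
    Matrix.of (Matrix.vecCons g fun j ↦ (b j : Fin (q + 2) → R))
  have hA : ι R g * Z = A.det • koszulTop R (q + 2) := by
    have h1 : ι R g * Z = ιMulti R (q + 2) (Matrix.vecCons g fun j ↦ (b j : Fin (q + 2) → R)) := by
      rw [ιMulti_succ_apply, Matrix.cons_val_zero, Matrix.tail_cons]
    rw [h1, eq_smul_koszulTop (ιMulti_range R _ ⟨_, rfl⟩), koszulTopCoord_ιMulti]
  let s : Fin (q + 2) → LinearMap.ker (koszulDual a) := fun l ↦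
    ⟨koszulDual a g • Pi.single l 1 - koszulDual a (Pi.single l 1) • g, by simp [mul_comm]⟩
  let B : Matrix (Fin (q + 2)) (Fin (q + 2)) R :=
    Matrix.of fun l ↦ Matrix.vecCons (koszulDual a (Pi.single l 1)) (b.repr (s l))
  have hBA : B * A = koszulDual a g • (1 : Matrix (Fin (q + 2)) (Fin (q + 2)) R) := by
    ext l m
    have h1 := congrArg (fun t : LinearMap.ker (koszulDual a) ↦ (t : Fin (q + 2) → R) m)
      (b.sum_repr (s l))
    simp only [Submodule.coe_sum, Finset.sum_apply, Submodule.coe_smul, Pi.smul_apply,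
      smul_eq_mul] at h1
    rw [Matrix.mul_apply, Fin.sum_univ_succ]
    simp only [A, B, Matrix.of_apply, Matrix.cons_val_zero, Matrix.cons_val_succ]
    rw [h1]
    simp [s, Matrix.one_apply, Pi.single_apply, eq_comm]
  have hdet : B.det * A.det = koszulDual a g ^ (q + 2) := by
    rw [← Matrix.det_mul, hBA, Matrix.det_smul, Matrix.det_one, mul_one, Fintype.card_fin]
  refine ⟨B.det * koszulDual a g, ?_⟩
  have h2 := congrArg (koszulDiff a) hA
  rw [koszulDiff_ι_mul, hZ, mul_zero, sub_zero, map_smul] at h2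
  rw [mul_smul, h2, ← mul_smul, hdet]

/-- The boundary of the top form is a multiple of the product of a basis of the syzygies. -/
theorem exists_koszulDiff_koszulTop_eq_smul {g h : Fin (q + 2) → R}
    (hgh : IsRegularPair (koszulDual a g) (koszulDual a h)) :
    ∃ v : R, koszulDiff a (koszulTop R (q + 2)) =
      v • ιMulti R (q + 1) (fun j ↦ (b j : Fin (q + 2) → R)) := by
  obtain ⟨c, hc⟩ := exists_pow_smul_koszulDiff_koszulTop b g
  obtain ⟨c', hc'⟩ := exists_pow_smul_koszulDiff_koszulTop b h
  set Z := ιMulti R (q + 1) (fun j ↦ (b j : Fin (q + 2) → R))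
  have hpow := hgh.pow (q + 2) (q + 2)
  have hZ : ∀ r : R, r • Z = 0 → r = 0 := by
    intro r hr
    have h1 : (koszulDual a g ^ (q + 2) * r) • koszulDiff a (koszulTop R (q + 2)) = 0 := by
      rw [mul_comm, mul_smul, hc, smul_comm, hr, smul_zero]
    exact hpow.eq_zero r (eq_zero_of_smul_koszulDiff_koszulTop hgh.eq_zero h1)
  have hcc : koszulDual a h ^ (q + 2) * c = koszulDual a g ^ (q + 2) * c' := by
    rw [← sub_eq_zero]
    apply hZ
    rw [sub_smul, mul_smul, mul_smul, ← hc, ← hc', smul_comm, sub_self]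
  obtain ⟨v, rfl⟩ := hpow.dvd c ⟨c', hcc⟩
  refine ⟨v, ?_⟩
  rw [← sub_eq_zero]
  apply eq_zero_of_smul_eq_zero hpow.eq_zero
  rw [smul_sub, hc, mul_smul, sub_self]

/-- An annihilator of the homology yields forms whose boundaries are dual to the basis of the
syzygies. -/
theorem exists_ι_mul_koszulDiff_eq_ite {i : ℕ} {x : R} (hx : x ∈ koszulAnn a i) (hi : i ≤ q)
    (j : Fin (q + 1)) :
    ∃ w ∈ koszulPiece R (q + 2) (q + 1), ∀ l, ι R (b l : Fin (q + 2) → R) * koszulDiff a w =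
      if l = j then x • ιMulti R (q + 1) (fun j ↦ (b j : Fin (q + 2) → R)) else 0 := by
  let v : Fin (q + 1) → Fin (q + 2) → R := fun l ↦ b (Equiv.swap 0 j l)
  have hcons : ∀ l, ι R (b l : Fin (q + 2) → R) * ιMulti R q (Matrix.vecTail v) =
      ιMulti R (q + 1) (Matrix.vecCons (b l : Fin (q + 2) → R) (Matrix.vecTail v)) := by
    intro l
    rw [ιMulti_succ_apply, Matrix.cons_val_zero, Matrix.tail_cons]
  obtain ⟨w, hw, hdw⟩ := smul_ιMulti_mem_koszulBoundaries hx hi (v := Matrix.vecTail v)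
    fun l ↦ (b (Equiv.swap 0 j l.succ)).2
  let ε : R := ((Equiv.Perm.sign (Equiv.swap 0 j) : ℤ) : R)
  have hε : ε * ε = 1 := by
    simp only [ε, ← Int.cast_mul, ← Units.val_mul, Int.units_mul_self, Units.val_one, Int.cast_one]
  refine ⟨ε • w, Submodule.smul_mem _ _ hw, fun l ↦ ?_⟩
  rw [map_smul, hdw, mul_smul_comm, mul_smul_comm, hcons]
  split_ifs with hl
  · subst hl
    have h1 : Matrix.vecCons (b l : Fin (q + 2) → R) (Matrix.vecTail v) =
        (fun j ↦ (b j : Fin (q + 2) → R)) ∘ Equiv.swap 0 l := by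
      have : (b l : Fin (q + 2) → R) = Matrix.vecHead v := by simp [v, Matrix.vecHead]
      rw [this, Matrix.cons_head_tail]
      rfl
    rw [h1, AlternatingMap.map_perm, Units.smul_def, ← Int.cast_smul_eq_zsmul R, smul_comm,
      smul_smul ε, hε, one_smul]
  · obtain ⟨m, hm⟩ : ∃ m : Fin q, m.succ = Equiv.swap 0 j l := by
      rw [Fin.exists_succ_eq]
      intro h0
      apply hl
      exact (Equiv.swap 0 j).injective (h0.trans (Equiv.swap_apply_right 0 j).symm)
    rw [AlternatingMap.map_eq_zero_of_eq _ _ (i := 0) (j := m.succ) _ (Fin.succ_ne_zero m).symm,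
      smul_zero, smul_zero]
    rw [Matrix.cons_val_zero, Matrix.cons_val_succ, Matrix.vecTail, Function.comp_apply, hm]
    simp [v]

theorem koszulAnn_le_range_koszulDual
    (b : Module.Basis (Fin (q + 1)) R (LinearMap.ker (koszulDual a))) {g h : Fin (q + 2) → R}
    (hgh : IsRegularPair (koszulDual a g) (koszulDual a h)) {i : ℕ} (hi : i ≤ q) :
    koszulAnn a i ≤ LinearMap.range (koszulDual a) := by
  intro x hx
  obtain ⟨v, hv⟩ := exists_koszulDiff_koszulTop_eq_smul b hgh
  choose w hw hdw using exists_ι_mul_koszulDiff_eq_ite b hx hi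
  set Z := ιMulti R (q + 1) (fun j ↦ (b j : Fin (q + 2) → R))
  have hZ : ∀ r : R, r • Z = 0 → r = 0 := by
    intro r hr
    apply eq_zero_of_smul_koszulDiff_koszulTop hgh.eq_zero
    rw [hv, smul_comm, hr, smul_zero]
  let ψ : Fin (q + 1) → (Fin (q + 2) → R) →ₗ[R] R := fun j ↦
    koszulTopCoord R (q + 2) ∘ₗ LinearMap.mulRight R (w j) ∘ₗ ι R
  have hψ : ∀ j l, -(v * ψ j (b l)) = if l = j then x else 0 := by
    intro j l
    have h1 := eq_smul_koszulTop (ι_mul_mem_koszulPiece (b l : Fin (q + 2) → R) (hw j))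
    have h2 := congrArg (koszulDiff a) h1
    rw [koszulDiff_ι_mul, hdw, (b l).2, zero_smul, zero_sub, map_smul, hv] at h2
    rw [← sub_eq_zero]
    apply hZ
    change _ = ψ j (b l) • v • Z at h2
    rw [sub_smul, neg_smul, mul_comm, mul_smul, ← h2]
    split_ifs <;> simp
  let T : (Fin (q + 2) → R) →ₗ[R] (Fin (q + 2) → R) :=
    ∑ j, (-(v • ψ j)).smulRight (b j : Fin (q + 2) → R) - x • LinearMap.id
  have hT : ∀ u, koszulDual a u = 0 → T u = 0 := by
    have h1 : T ∘ₗ (LinearMap.ker (koszulDual a)).subtype = 0 := by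
      refine b.ext fun l ↦ ?_
      simp only [T, LinearMap.comp_apply, LinearMap.sub_apply, LinearMap.sum_apply,
        LinearMap.smulRight_apply, LinearMap.neg_apply, LinearMap.smul_apply,
        Submodule.subtype_apply, smul_eq_mul, hψ, LinearMap.id_apply, LinearMap.zero_apply]
      simp
    exact fun u hu ↦ congrArg (fun f ↦ f ⟨u, hu⟩) h1
  have hdT : ∀ u, koszulDual a (T u) = -(x * koszulDual a u) := by
    intro u
    simp [T, map_sub, map_sum]
  have hsymm : koszulDual a h • T g = koszulDual a g • T h := by
    rw [← sub_eq_zero, ← map_smul, ← map_smul, ← map_sub]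
    apply hT
    rw [map_sub, map_smul, map_smul, smul_eq_mul, smul_eq_mul, mul_comm, sub_self]
  choose k hk using fun m ↦ hgh.dvd (T g m) ⟨T h m, congrFun hsymm m⟩
  have hTg : T g = koszulDual a g • k := funext hk
  refine ⟨-k, ?_⟩
  rw [← sub_eq_zero]
  apply hgh.eq_zero
  have h1 := hdT g
  rw [hTg, map_smul, smul_eq_mul] at h1
  rw [map_neg]
  linear_combination -h1

end HilbertBurch

end KoszulHomology

/-- **Proposition.**  Let `R` be a local Cohen–Macaulay ring and `I` a height two
perfect ideal (perfect: the grade of `I` equals the projective dimension of `R/I`).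
Then for every `i` with `H_i(I) ≠ 0` one has `Ann H_i(I) = I`, for the Koszul homology
of a minimal generating set of `I`. -/
theorem ann_koszul_homology_of_height_two_perfect
    {R : Type u} [CommRing R] [IsLocalRing R] [IsNoetherianRing R]
    (hCM : IsCohenMacaulayLocalRing R)
    (I : Ideal R) (hht : idealHeight I = 2)
    (hperfect : ∃ g : ℕ, I.HasGrade g ∧ ProjDimEq R (R ⧸ I) g)
    {k : ℕ} (a : Fin k → R) (ha : IsMinGen a I)
    (i : ℕ) (hne : Nontrivial (koszulHomology a i)) :
    koszulAnn a i = I := by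
  obtain ⟨g, hgrade, hpd⟩ := hperfect
  rw [idealHeight_eq_height] at hht
  obtain rfl := projDim_eq_two_of_height_eq_two hht hgrade hpd.1
  obtain ⟨y, hy, z, hz, hyz⟩ := exists_isRegularPair hgrade
  obtain rfl : LinearMap.range (koszulDual a) = I := (range_koszulDual a).trans ha.1
  obtain ⟨g, rfl⟩ := hy
  obtain ⟨h, rfl⟩ := hz
  have hik : i + 2 ≤ k := by
    by_contra hlt
    exact not_nontrivial_koszulHomology hyz (by lia) hne
  obtain ⟨q, rfl⟩ : ∃ q, k = q + 2 := ⟨k - 2, by lia⟩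
  obtain ⟨b⟩ := exists_basis_ker_koszulDual hyz.eq_zero
    (projective_ker_of_hasProjDimLE_two (koszulDual a) hpd.1)
  refine le_antisymm (koszulAnn_le_range_koszulDual b hyz (by lia)) ?_
  rintro _ ⟨v, rfl⟩
  exact koszulDual_mem_koszulAnn v i
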